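/- Let k be a field of characteristic not 2 containing an element i with i² = -1, and let n ≥ 1. If A ∈ Sp(2n,k) satisfies A² = -I, then there exists an invertible 2n×2n matrix X over k such that A = X·[[i·Iₙ, 0],[0, -i·Iₙ]]·X⁻¹ and XᵀJX = [[0, X₁],[-X₁, 0]] for some diagonal n×n matrix X₁. -/

import Mathlib

open Matrix

/-- The standard symplectic form matrix `J = [[0, Iₙ], [-Iₙ, 0]]`. -/
def SpJ (n : ℕ) (R : Type*) [CommRing R] : Matrix (Fin n ⊕ Fin n) (Fin n ⊕ Fin n) R :=
  Matrix.fromBlocks 0 1 (-1) 0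

/-- `M` belongs to the symplectic group `Sp(2n,R)`, i.e. `Mᵀ J M = J`. -/
def IsSymp {n : ℕ} {R : Type*} [CommRing R]
    (M : Matrix (Fin n ⊕ Fin n) (Fin n ⊕ Fin n) R) : Prop :=
  Mᵀ * SpJ n R * M = SpJ n R

theorem SpJ_mul_self (n : ℕ) (R : Type*) [CommRing R] : SpJ n R * SpJ n R = -1 := by
  rw [SpJ, fromBlocks_multiply, ← fromBlocks_one, fromBlocks_neg]
  simp

theorem SpJ_transpose (n : ℕ) (R : Type*) [CommRing R] : (SpJ n R)ᵀ = -SpJ n R := by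
  rw [SpJ, fromBlocks_transpose, fromBlocks_neg]
  simp

theorem isUnit_SpJ (n : ℕ) (R : Type*) [CommRing R] : IsUnit (SpJ n R) :=
  IsUnit.of_mul_eq_one (-SpJ n R) (by rw [mul_neg, SpJ_mul_self, neg_neg])

/-- If `A` is symplectic and `A² = -1`, then `A - a` and `A + a` have the same rank. -/
theorem IsSymp.rank_sub_eq_rank_add {k : Type*} [Field k] {n : ℕ}
    {A : Matrix (Fin n ⊕ Fin n) (Fin n ⊕ Fin n) k} (hA : IsSymp A) (h2 : A * A = -1) (a : k) :
    (A - a • 1).rank = (A + a • 1).rank := by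
  have hJ : Aᵀ * SpJ n k = -(SpJ n k * A) := by
    have h : Aᵀ * SpJ n k * A * A = SpJ n k * A := by rw [hA]
    rw [mul_assoc, h2, mul_neg, mul_one] at h
    rw [← h, neg_neg]
  have hJ' : (A + a • 1)ᵀ * SpJ n k = (-SpJ n k) * (A - a • 1) := by
    rw [transpose_add, add_mul, hJ, transpose_smul, transpose_one]
    simp [mul_sub]
  have hu : IsUnit (SpJ n k).det := (isUnit_iff_isUnit_det _).1 (isUnit_SpJ n k)
  have hu' : IsUnit (-SpJ n k).det := (isUnit_iff_isUnit_det _).1 (isUnit_SpJ n k).neg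
  rw [← rank_transpose (A + a • 1), ← rank_mul_eq_left_of_isUnit_det _ (A + a • 1)ᵀ hu, hJ',
    rank_mul_eq_right_of_isUnit_det _ _ hu']

/-- If `a² = -1`, `2 ≠ 0` and `A² = -1`, then the eigenspaces of `A` for `a` and `-a` are
complementary. -/
theorem isCompl_ker_sub_ker_add {k ι : Type*} [Field k] [Fintype ι] [DecidableEq ι]
    (hchar : (2 : k) ≠ 0) {a : k} (ha : a ^ 2 = -1) {A : Matrix ι ι k} (h2 : A * A = -1) :
    IsCompl (LinearMap.ker (A - a • 1).mulVecLin) (LinearMap.ker (A + a • 1).mulVecLin) := by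
  have ha0 : a ≠ 0 := by
    rintro rfl
    simp at ha
  constructor
  · rw [Submodule.disjoint_def]
    intro v hv hw
    simp only [LinearMap.mem_ker, mulVecLin_apply, sub_mulVec, add_mulVec, smul_mulVec,
      one_mulVec] at hv hw
    have h : (2 * a) • v = 0 := by
      rw [← sub_eq_zero.2 (hw.trans hv.symm)]
      module
    exact (smul_eq_zero.1 h).resolve_left (mul_ne_zero hchar ha0)
  · rw [codisjoint_iff, eq_top_iff]
    intro v _
    have hAA : A *ᵥ (A *ᵥ v) = -v := by rw [mulVec_mulVec, h2, neg_mulVec, one_mulVec]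
    refine Submodule.mem_sup.2 ⟨(2 * a)⁻¹ • (A *ᵥ v + a • v), ?_,
      (2 * a)⁻¹ • (a • v - A *ᵥ v), ?_, ?_⟩
    · simp only [LinearMap.mem_ker, mulVecLin_apply, mulVec_smul, sub_mulVec, smul_mulVec,
        one_mulVec, mulVec_add, hAA]
      rw [show -v - a • A *ᵥ v + a • (A *ᵥ v - a • v) = (-1 - a ^ 2) • v by module, ha]
      simp
    · simp only [LinearMap.mem_ker, mulVecLin_apply, mulVec_smul, add_mulVec, smul_mulVec,
        one_mulVec, mulVec_sub, hAA]
      rw [show a • (A *ᵥ v + a • v) - (-v + a • A *ᵥ v) = (1 + a ^ 2) • v by module, ha]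
      simp
    · rw [← smul_add, show A *ᵥ v + a • v + (a • v - A *ᵥ v) = (2 * a) • v by module,
        smul_smul, inv_mul_cancel₀ (mul_ne_zero hchar ha0), one_smul]

/-- A symplectic `A` with `A² = -1` is diagonalizable with both eigenvalues `±a` of
multiplicity `n`. -/
theorem IsSymp.exists_isUnit_mul_eq {k : Type*} [Field k] (hchar : (2 : k) ≠ 0)
    {a : k} (ha : a ^ 2 = -1) {n : ℕ} {A : Matrix (Fin n ⊕ Fin n) (Fin n ⊕ Fin n) k}
    (hA : IsSymp A) (h2 : A * A = -1) :
    ∃ P : Matrix (Fin n ⊕ Fin n) (Fin n ⊕ Fin n) k, IsUnit P ∧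
      A * P = P * fromBlocks (a • (1 : Matrix (Fin n) (Fin n) k)) 0 0
        (-a • (1 : Matrix (Fin n) (Fin n) k)) := by
  have hc := isCompl_ker_sub_ker_add hchar ha h2
  have hr := hA.rank_sub_eq_rank_add h2 a
  have hsum := Submodule.finrank_add_eq_of_isCompl hc
  have h₁ := LinearMap.finrank_range_add_finrank_ker (A - a • 1).mulVecLin
  have h₂ := LinearMap.finrank_range_add_finrank_ker (A + a • 1).mulVecLin
  simp only [Matrix.rank] at hr
  simp only [Module.finrank_fintype_fun_eq_card, Fintype.card_sum, Fintype.card_fin]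
    at hsum h₁ h₂
  let b₁ := Module.finBasisOfFinrankEq k (LinearMap.ker (A - a • 1).mulVecLin)
    (n := n) (by omega)
  let b₂ := Module.finBasisOfFinrankEq k (LinearMap.ker (A + a • 1).mulVecLin)
    (n := n) (by omega)
  let b := (b₁.prod b₂).map (Submodule.prodEquivOfIsCompl _ _ hc)
  have hb₁ (j : Fin n) : A *ᵥ b (Sum.inl j) = a • b (Sum.inl j) := by
    have h := (b₁ j).2
    simp only [LinearMap.mem_ker, mulVecLin_apply, sub_mulVec, smul_mulVec, one_mulVec] at h
    simpa [b] using sub_eq_zero.1 h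
  have hb₂ (j : Fin n) : A *ᵥ b (Sum.inr j) = -a • b (Sum.inr j) := by
    have h := (b₂ j).2
    simp only [LinearMap.mem_ker, mulVecLin_apply, add_mulVec, smul_mulVec, one_mulVec] at h
    simpa [b] using eq_neg_of_add_eq_zero_left h
  refine ⟨(Pi.basisFun k _).toMatrix b, ?_, ?_⟩
  · exact IsUnit.of_mul_eq_one _ (Module.Basis.toMatrix_mul_toMatrix_flip _ _)
  · have hD : fromBlocks (a • (1 : Matrix (Fin n) (Fin n) k)) 0 0
        (-a • (1 : Matrix (Fin n) (Fin n) k)) =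
        diagonal (Sum.elim (fun _ => a) (fun _ => -a)) := by
      rw [← fromBlocks_diagonal, smul_one_eq_diagonal, smul_one_eq_diagonal]
    rw [hD]
    ext r (j | j)
    · rw [mul_diagonal]
      simpa [Module.Basis.toMatrix, mul_apply, mulVec, dotProduct, mul_comm] using
        congrFun (hb₁ j) r
    · rw [mul_diagonal]
      simpa [Module.Basis.toMatrix, mul_apply, mulVec, dotProduct, mul_comm] using
        congrFun (hb₂ j) r

/-- If `k` contains `i` with `i² = -1` and `A ∈ Sp(2n,k)` satisfies `A² = -I`, then `A` is
conjugate by some invertible `X` to `[[i·Iₙ,0],[0,-i·Iₙ]]` with `XᵀJX = [[0,X₁],[-X₁,0]]`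
for a diagonal matrix `X₁`. -/
theorem stmt12 {k : Type*} [Field k] (hchar : (2 : k) ≠ 0)
    (i : k) (hi : i ^ 2 = -1) {n : ℕ} (hn : 1 ≤ n)
    (A : Matrix (Fin n ⊕ Fin n) (Fin n ⊕ Fin n) k) (hA : IsSymp A)
    (h2 : A * A = -1) :
    ∃ X : Matrix (Fin n ⊕ Fin n) (Fin n ⊕ Fin n) k, IsUnit X ∧
      A = X * Matrix.fromBlocks (i • (1 : Matrix (Fin n) (Fin n) k)) 0 0
            (-i • (1 : Matrix (Fin n) (Fin n) k)) * X⁻¹ ∧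
      ∃ d : Fin n → k,
        Xᵀ * SpJ n k * X =
          Matrix.fromBlocks 0 (Matrix.diagonal d) (-(Matrix.diagonal d)) 0 := by
  have eq_zero_of_eq_neg {M : Matrix (Fin n) (Fin n) k} (h : M = -M) : M = 0 := by
    have h' : (2 : k) • M = 0 := by
      rw [two_smul]
      exact eq_neg_iff_add_eq_zero.1 h
    exact (smul_eq_zero.1 h').resolve_left hchar
  have hii : i * i = -1 := by rw [← sq, hi]
  obtain ⟨P, hP, hAP⟩ := hA.exists_isUnit_mul_eq hchar hi h2
  set D := fromBlocks (i • (1 : Matrix (Fin n) (Fin n) k)) 0 0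
    (-i • (1 : Matrix (Fin n) (Fin n) k)) with hD
  obtain ⟨G, hG⟩ : ∃ G, G = Pᵀ * SpJ n k * P := ⟨_, rfl⟩
  have hDT : Dᵀ = D := by simp [hD, fromBlocks_transpose]
  have hDGD : D * G * D = G := by
    calc D * G * D = (P * D)ᵀ * SpJ n k * (P * D) := by
          rw [hG, transpose_mul, hDT]
          simp only [mul_assoc]
      _ = Pᵀ * (Aᵀ * SpJ n k * A) * P := by
          rw [← hAP, transpose_mul]
          simp only [mul_assoc]
      _ = G := by rw [hA, hG]
  have hGT : Gᵀ = -G := by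
    rw [hG, transpose_mul, transpose_mul, SpJ_transpose, transpose_transpose]
    simp [mul_assoc]
  have hGu : IsUnit G := by
    rw [hG]
    exact (((isUnit_transpose P).2 hP).mul (isUnit_SpJ n k)).mul hP
  obtain ⟨H, hGH⟩ := hGu.exists_right_inv
  rw [← fromBlocks_toBlocks G] at hDGD hGT hGH
  rw [← fromBlocks_toBlocks H, fromBlocks_multiply, ← fromBlocks_one, fromBlocks_inj] at hGH
  rw [hD, fromBlocks_multiply, fromBlocks_multiply, fromBlocks_inj] at hDGD
  rw [fromBlocks_transpose, fromBlocks_neg, fromBlocks_inj] at hGT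
  have h₁₁ : G.toBlocks₁₁ = 0 := eq_zero_of_eq_neg (by simpa [smul_smul, hii] using hDGD.1.symm)
  have h₂₂ : G.toBlocks₂₂ = 0 :=
    eq_zero_of_eq_neg (by simpa [smul_smul, hii] using hDGD.2.2.2.symm)
  have h₂₁ : G.toBlocks₂₁ = -G.toBlocks₁₂ᵀ := by rw [hGT.2.2.1, neg_neg]
  have h₁₂ : G.toBlocks₁₂ * H.toBlocks₂₁ = 1 := by simpa [h₁₁] using hGH.1
  obtain ⟨Y, hY⟩ : ∃ Y : Matrix (Fin n ⊕ Fin n) (Fin n ⊕ Fin n) k,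
    Y = fromBlocks 1 0 0 H.toBlocks₂₁ := ⟨_, rfl⟩
  have hYD : D * Y = Y * D := by simp [hY, hD, fromBlocks_multiply]
  have hX : (P * Y)ᵀ * SpJ n k * (P * Y) = SpJ n k := by
    calc (P * Y)ᵀ * SpJ n k * (P * Y) = Yᵀ * G * Y := by
          rw [hG, transpose_mul]
          simp only [mul_assoc]
      _ = SpJ n k := by
          rw [← fromBlocks_toBlocks G, h₁₁, h₂₂, h₂₁, hY, fromBlocks_transpose,
            fromBlocks_multiply, fromBlocks_multiply, SpJ]
          simp [h₁₂, ← transpose_mul]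
  have hXu : IsUnit (P * Y) := by
    have h := isUnit_SpJ n k
    rw [← hX] at h
    exact isUnit_of_mul_isUnit_right h
  refine ⟨P * Y, hXu, ?_, 1, ?_⟩
  · rw [mul_assoc P Y, ← hYD, ← mul_assoc, ← hAP, mul_assoc A,
      mul_nonsing_inv_cancel_right _ _ ((isUnit_iff_isUnit_det _).1 hXu)]
  · rw [hX, SpJ]
    simp
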